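/- In the matrix Charlier setting with general parameters, let J = diag(1,2,…,N), fix λ ∈ ℕ₀, and let (P_n^{(λ)}) be the monic orthogonal sequence of the weight W^{(λ)}. Then for every n ∈ ℕ₀ the second order difference equation P_n^{(λ)}(x+1)·a(I+A) − P_n^{(λ)}(x)·(J + (x+λ)(I+A)^{−1}) + P_n^{(λ)}(x−1)·x(I+A)^{−1} = Γ_n^{(λ)}·P_n^{(λ)}(x) holds as an identity of matrix polynomials in x (for all x ∈ ℂ), with eigenvalue Γ_n^{(λ)} = a(I+A) − J − (n+λ)(I+A)^{−1}. -/

import Mathlib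

open scoped BigOperators ComplexOrder
open Matrix Polynomial

noncomputable section

/-- The space of `N × N` complex matrices, with rows and columns indexed by `Fin N`
(the index `j : Fin N` corresponds to the row/column `j+1 ∈ {1,…,N}` of the paper). -/
abbrev Mat (N : ℕ) := Matrix (Fin N) (Fin N) ℂ

/-- Evaluation of a matrix polynomial at a (scalar) complex number. -/
def matEval {N : ℕ} (P : Polynomial (Mat N)) (z : ℂ) : Mat N :=
  P.eval (z • (1 : Mat N))

/-- The scalar Charlier polynomial
`c_n^{(a)}(x) = ∑_{k=0}^n ((-n)_k (-x)_k / k!) (-1/a)^k`. -/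
def charlier (a : ℂ) (n : ℕ) (x : ℂ) : ℂ :=
  ∑ k ∈ Finset.range (n + 1),
    (ascPochhammer ℂ k).eval (-(n : ℂ)) * (ascPochhammer ℂ k).eval (-x)
      / (k.factorial : ℂ) * (-(1 / a)) ^ k

/-- The nilpotent matrix `A` with `A_{j+1,j} = μ_{j+1}/μ_j` (paper indices `1,…,N`). -/
def Amat (N : ℕ) (μ : ℕ → ℝ) : Mat N :=
  Matrix.of fun j k : Fin N =>
    if (j : ℕ) = (k : ℕ) + 1 then ((μ ((j : ℕ) + 1) / μ ((k : ℕ) + 1) : ℝ) : ℂ) else 0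

/-- The diagonal matrix `T = diag(δ_1,…,δ_N)`. -/
def Tmat (N : ℕ) (δ : ℕ → ℝ) : Mat N :=
  Matrix.diagonal fun k : Fin N => ((δ ((k : ℕ) + 1) : ℝ) : ℂ)

/-- The matrix Charlier weight
`W^{(λ)}(x) = (a^x/x!) (I+A)^{x+λ} T^{(λ)} (I+A^*)^{x+λ}`. -/
def Wch (N : ℕ) (a : ℝ) (μ δ : ℕ → ℝ) (lam x : ℕ) : Mat N :=
  ((a ^ x / x.factorial : ℝ) : ℂ) •
    ((1 + Amat N μ) ^ (x + lam) * Tmat N δ * (1 + (Amat N μ)ᴴ) ^ (x + lam))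

/-- The unipotent lower triangular matrix `L(x)` with entries
`L(x)_{j,k} = (μ_j/μ_k)(-a)^{j-k} c_{j-k}^{(a)}(x)/(j-k)!` for `j ≥ k`. -/
def Lmat (N : ℕ) (a : ℝ) (μ : ℕ → ℝ) (z : ℂ) : Mat N :=
  Matrix.of fun j k : Fin N =>
    if (k : ℕ) ≤ (j : ℕ) then
      ((μ ((j : ℕ) + 1) / μ ((k : ℕ) + 1) : ℝ) : ℂ) * (-(a : ℂ)) ^ ((j : ℕ) - (k : ℕ))
        * charlier (a : ℂ) ((j : ℕ) - (k : ℕ)) z / ((((j : ℕ) - (k : ℕ)).factorial) : ℂ)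
    else 0

/-- Matrix-valued inner product for a weight supported on `ℕ₀`. -/
def innerN {N : ℕ} (W : ℕ → Mat N) (P Q : Polynomial (Mat N)) : Mat N :=
  ∑' x : ℕ, matEval P x * W x * (matEval Q x)ᴴ

/-- `P` is the monic orthogonal sequence of the weight `W` supported on `ℕ₀`. -/
structure IsMOSN {N : ℕ} (W : ℕ → Mat N) (P : ℕ → Polynomial (Mat N)) : Prop where
  monic : ∀ n, (P n).Monic
  deg : ∀ n, (P n).natDegree = n
  orth : ∀ m n, m ≠ n → innerN W (P m) (P n) = 0

/-- The diagonal matrix `J = diag(1,2,…,N)`. -/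
def Jdiag (N : ℕ) : Mat N := Matrix.diagonal fun j : Fin N => ((j : ℕ) + 1 : ℂ)

/-- Matrix-valued polynomial functions of degree less than `d`. -/
def polyFun (N d : ℕ) : Submodule ℂ (ℂ → Mat N) :=
  Submodule.span ℂ {f | ∃ k < d, ∃ C : Mat N, f = fun z => z ^ k • C}

theorem pow_smul_mem_polyFun {N d k : ℕ} (h : k < d) (C : Mat N) :
    (fun z : ℂ => z ^ k • C) ∈ polyFun N d :=
  Submodule.subset_span ⟨k, h, C, rfl⟩

theorem polyFun_mono {N d e : ℕ} (h : d ≤ e) : polyFun N d ≤ polyFun N e :=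
  Submodule.span_mono fun _ ⟨k, hk, C, hf⟩ => ⟨k, hk.trans_le h, C, hf⟩

theorem eval_smul_mem_polyFun {N d : ℕ} {p : ℂ[X]} (hp : p ∈ degreeLT ℂ d) (C : Mat N) :
    (fun z : ℂ => p.eval z • C) ∈ polyFun N d := by
  have : (fun z : ℂ => p.eval z • C)
      = ∑ k ∈ p.support, p.coeff k • fun z : ℂ => z ^ k • C := by
    ext1 z
    simp [eval_eq_sum, Polynomial.sum, Finset.sum_smul, mul_smul]
  rw [this]
  refine Submodule.sum_mem _ fun k hk => Submodule.smul_mem _ _ (pow_smul_mem_polyFun ?_ C)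
  by_contra! h
  exact (mem_support_iff.1 hk)
    (coeff_eq_zero_of_degree_lt ((mem_degreeLT.1 hp).trans_le (by exact_mod_cast h)))

/-- Left multiplication by a constant matrix. -/
def leftMul {N : ℕ} (C : Mat N) : (ℂ → Mat N) →ₗ[ℂ] (ℂ → Mat N) where
  toFun f z := C * f z
  map_add' f g := by ext1 z; simp [mul_add]
  map_smul' c f := by ext1 z; simp

/-- Shift of the variable by `s` followed by multiplication by `q z` and, on the right, by `C`. -/
def shiftMul {N : ℕ} (s : ℂ) (q : ℂ → ℂ) (C : Mat N) : (ℂ → Mat N) →ₗ[ℂ] (ℂ → Mat N) where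
  toFun f z := q z • (f (z + s) * C)
  map_add' f g := by ext1 z; simp [add_mul]
  map_smul' c f := by ext1 z; simp [smul_comm c]

theorem map_mem_polyFun {N d e : ℕ} (L : (ℂ → Mat N) →ₗ[ℂ] (ℂ → Mat N))
    (hL : ∀ k < d, ∀ C : Mat N, L (fun z => z ^ k • C) ∈ polyFun N e)
    {f : ℂ → Mat N} (hf : f ∈ polyFun N d) : L f ∈ polyFun N e := by
  have : (polyFun N d).map L ≤ polyFun N e := by
    rw [polyFun, Submodule.map_span_le]
    rintro _ ⟨k, hk, C, rfl⟩
    exact hL k hk C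
  exact this (Submodule.mem_map_of_mem hf)

theorem leftMul_mem_polyFun {N d : ℕ} (C : Mat N) {f : ℂ → Mat N} (hf : f ∈ polyFun N d) :
    leftMul C f ∈ polyFun N d := by
  refine map_mem_polyFun _ (fun k hk D => ?_) hf
  convert pow_smul_mem_polyFun hk (C * D) using 2
  simp [leftMul]

theorem shiftMul_mem_polyFun {N d e : ℕ} (s : ℂ) {r : ℂ → ℂ} (q : ℂ[X]) (C : Mat N)
    (hr : ∀ z, r z = q.eval z) (hq : q.natDegree + d ≤ e) {f : ℂ → Mat N} (hf : f ∈ polyFun N d) :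
    shiftMul s r C f ∈ polyFun N e := by
  refine map_mem_polyFun _ (fun k hk D => ?_) hf
  have hp : q * (X + Polynomial.C s) ^ k ∈ degreeLT ℂ e := by
    rw [mem_degreeLT]
    refine lt_of_le_of_lt degree_le_natDegree ?_
    have h1 := natDegree_mul_le (p := q) (q := (X + Polynomial.C s) ^ k)
    rw [natDegree_pow, natDegree_X_add_C] at h1
    exact_mod_cast (by lia)
  convert eval_smul_mem_polyFun hp (D * C) using 2
  simp [shiftMul, mul_smul, hr]

theorem exists_eval_entry {N d : ℕ} {f : ℂ → Mat N} (hf : f ∈ polyFun N d) (i j : Fin N) :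
    ∃ p : ℂ[X], ∀ z, f z i j = p.eval z := by
  induction hf using Submodule.span_induction with
  | mem f h =>
    obtain ⟨k, -, C, rfl⟩ := h
    exact ⟨X ^ k * Polynomial.C (C i j), fun z => by simpa using mul_comm _ _⟩
  | zero => exact ⟨0, by simp⟩
  | add f g _ _ hf hg =>
    obtain ⟨p, hp⟩ := hf
    obtain ⟨q, hq⟩ := hg
    exact ⟨p + q, fun z => by simp [hp, hq]⟩
  | smul c f _ hf =>
    obtain ⟨p, hp⟩ := hf
    exact ⟨Polynomial.C c * p, fun z => by simp [hp]⟩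

theorem eq_zero_of_natCast_eq_zero {N d : ℕ} {f : ℂ → Mat N} (hf : f ∈ polyFun N d)
    (h : ∀ x : ℕ, f x = 0) : f = 0 := by
  ext z i j
  obtain ⟨p, hp⟩ := exists_eval_entry hf i j
  have : p = 0 := by
    refine eq_zero_of_infinite_isRoot p
      ((Set.infinite_range_of_injective (Nat.cast_injective (R := ℂ))).mono ?_)
    rintro _ ⟨x, rfl⟩
    simp [IsRoot, ← hp, h]
  simp [hp, this]

theorem matEval_eq_sum {N : ℕ} (P : Polynomial (Mat N)) (z : ℂ) :
    matEval P z = ∑ k ∈ Finset.range (P.natDegree + 1), z ^ k • P.coeff k := by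
  simp [matEval, eval_eq_sum_range, _root_.smul_pow]

theorem matEval_mem_polyFun {N n : ℕ} {P : Polynomial (Mat N)} (hd : P.natDegree = n) :
    matEval P ∈ polyFun N (n + 1) := by
  have : matEval P = ∑ k ∈ Finset.range (n + 1), fun z : ℂ => z ^ k • P.coeff k := by
    ext1 z
    simp [matEval_eq_sum, hd]
  rw [this]
  exact Submodule.sum_mem _ fun k hk => pow_smul_mem_polyFun (Finset.mem_range.1 hk) _

theorem matEval_sub_mem_polyFun {N n : ℕ} {P : Polynomial (Mat N)} (hm : P.Monic)
    (hd : P.natDegree = n) :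
    (matEval P - fun z : ℂ => z ^ n • (1 : Mat N)) ∈ polyFun N n := by
  have : (matEval P - fun z : ℂ => z ^ n • (1 : Mat N))
      = ∑ k ∈ Finset.range n, fun z : ℂ => z ^ k • P.coeff k := by
    ext1 z
    have hc : P.coeff n = 1 := by rw [← hd]; exact hm
    simp [matEval_eq_sum, hd, Finset.sum_range_succ, hc]
  rw [this]
  exact Submodule.sum_mem _ fun k hk => pow_smul_mem_polyFun (Finset.mem_range.1 hk) _

section Norm

open scoped Matrix.Norms.L2Operator

theorem exists_norm_le_of_mem_polyFun {N d : ℕ} {f : ℂ → Mat N} (hf : f ∈ polyFun N d) :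
    ∃ c : ℝ, 0 ≤ c ∧ ∀ x : ℕ, ‖f x‖ ≤ c * (2 ^ d) ^ x := by
  induction hf using Submodule.span_induction with
  | mem f h =>
    obtain ⟨k, hk, C, rfl⟩ := h
    refine ⟨‖C‖, norm_nonneg _, fun x => ?_⟩
    have hx : (x : ℝ) ≤ 2 ^ x := by exact_mod_cast Nat.lt_two_pow_self.le
    rw [norm_smul, norm_pow, Complex.norm_natCast, mul_comm]
    gcongr
    calc (x : ℝ) ^ k ≤ (2 ^ x) ^ k := by gcongr
      _ ≤ (2 ^ x) ^ d := pow_le_pow_right₀ (one_le_pow₀ (by norm_num)) hk.le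
      _ = (2 ^ d) ^ x := by rw [← pow_mul, ← pow_mul, mul_comm]
  | zero => exact ⟨0, le_rfl, by simp⟩
  | add f g _ _ hf hg =>
    obtain ⟨p, hp0, hp⟩ := hf
    obtain ⟨q, hq0, hq⟩ := hg
    refine ⟨p + q, by positivity, fun x => (norm_add_le _ _).trans ?_⟩
    rw [add_mul]
    exact add_le_add (hp x) (hq x)
  | smul c f _ hf =>
    obtain ⟨p, hp0, hp⟩ := hf
    refine ⟨‖c‖ * p, by positivity, fun x => ?_⟩
    rw [Pi.smul_apply, norm_smul, mul_assoc]
    gcongr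
    exact hp x

theorem summable_innerN_Wch {N : ℕ} (hN : 1 ≤ N) {a : ℝ} (ha : 0 < a) (μ δ : ℕ → ℝ) (lam : ℕ)
    {d e : ℕ} {f g : ℂ → Mat N} (hf : f ∈ polyFun N d) (hg : g ∈ polyFun N e) :
    Summable fun x : ℕ => f x * Wch N a μ δ lam x * (g x)ᴴ := by
  have : Nonempty (Fin N) := ⟨⟨0, hN⟩⟩
  obtain ⟨p, hp0, hp⟩ := exists_norm_le_of_mem_polyFun hf
  obtain ⟨q, hq0, hq⟩ := exists_norm_le_of_mem_polyFun hg
  set B := 1 + Amat N μ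
  set B' := 1 + (Amat N μ)ᴴ
  set K := 2 ^ d * (a * ‖B‖ * ‖B'‖) * 2 ^ e
  refine Summable.of_norm_bounded
    (g := fun x => (p * (‖B‖ ^ lam * ‖Tmat N δ‖ * ‖B'‖ ^ lam) * q) * (K ^ x / x.factorial))
    ((Real.summable_pow_div_factorial K).mul_left _) fun x => ?_
  have hW : ‖Wch N a μ δ lam x‖
      ≤ a ^ x / x.factorial * (‖B‖ ^ (x + lam) * ‖Tmat N δ‖ * ‖B'‖ ^ (x + lam)) := by
    rw [Wch, norm_smul, Complex.norm_real, Real.norm_of_nonneg (by positivity)]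
    gcongr
    refine (norm_mul_le _ _).trans ?_
    gcongr
    · refine (norm_mul_le _ _).trans ?_
      gcongr
      exact norm_pow_le _ _
    · exact norm_pow_le _ _
  calc ‖f x * Wch N a μ δ lam x * (g x)ᴴ‖
      ≤ ‖f x‖ * ‖Wch N a μ δ lam x‖ * ‖(g x)ᴴ‖ := norm_mul₃_le
    _ ≤ (p * (2 ^ d) ^ x)
        * (a ^ x / x.factorial * (‖B‖ ^ (x + lam) * ‖Tmat N δ‖ * ‖B'‖ ^ (x + lam)))
        * (q * (2 ^ e) ^ x) := by
      gcongr
      · exact hp x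
      · exact (l2_opNorm_conjTranspose _).trans_le (hq x)
    _ = _ := by simp only [K, mul_pow, pow_add]; ring

end Norm

/-- The sesquilinear pairing of matrix-valued functions attached to a weight on `ℕ`. -/
def pairing {N : ℕ} (W : ℕ → Mat N) (f g : ℂ → Mat N) : Mat N :=
  ∑' x : ℕ, f x * W x * (g x)ᴴ

theorem det_one_add_Amat (N : ℕ) (μ : ℕ → ℝ) : (1 + Amat N μ).det = 1 := by
  rw [det_of_isLowerTriangular]
  · refine Finset.prod_eq_one fun i _ => ?_
    simp [Amat]
  · intro i j hij
    have hij' : (i : ℕ) < j := hij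
    have h1 : i ≠ j := fun h => by simp [h] at hij'
    have h2 : (i : ℕ) ≠ j + 1 := by lia
    simp [Amat, h1, h2]

theorem Jdiag_mul_Amat (N : ℕ) (μ : ℕ → ℝ) :
    Jdiag N * Amat N μ = Amat N μ * Jdiag N + Amat N μ := by
  ext i j
  simp only [Jdiag, Amat, diagonal_mul, mul_diagonal, Matrix.add_apply, of_apply]
  split_ifs with h
  · rw [h]; push_cast; ring
  · simp

theorem Jdiag_mul_pow (N : ℕ) (μ : ℕ → ℝ) (m : ℕ) :
    (Jdiag N + (m : ℂ) • (1 + Amat N μ)⁻¹) * (1 + Amat N μ) ^ m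
      = (1 + Amat N μ) ^ m * (Jdiag N + (m : ℂ) • 1) := by
  set B := 1 + Amat N μ with hB
  have hu : IsUnit B.det := by rw [hB, det_one_add_Amat]; exact isUnit_one
  have hJ : Jdiag N * B = B * Jdiag N + (B - 1) := by
    rw [hB, mul_add, Jdiag_mul_Amat]; noncomm_ring
  have key : ∀ m : ℕ, Jdiag N * B ^ m + (m : ℂ) • (B⁻¹ * B ^ m)
      = B ^ m * Jdiag N + (m : ℂ) • B ^ m := by
    intro m
    induction m with
    | zero => simp
    | succ m ih =>
      have h1 : B⁻¹ * B ^ (m + 1) = B ^ m := by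
        rw [pow_succ', nonsing_inv_mul_cancel_left _ _ hu]
      have h2 : B⁻¹ * B ^ m * B = B ^ m := by rw [mul_assoc, ← pow_succ, h1]
      have h3 := congrArg (· * B) ih
      simp only [add_mul, smul_mul_assoc, h2, mul_assoc (B ^ m) (Jdiag N) B, hJ] at h3
      rw [h1, pow_succ, ← mul_assoc, eq_sub_of_add_eq h3]
      push_cast
      simp only [add_smul, one_smul, mul_add, mul_sub, mul_one, ← mul_assoc]
      abel
  rw [add_mul, smul_mul_assoc, key, mul_add, mul_smul_comm, mul_one]

theorem conjTranspose_one_add_Amat (N : ℕ) (μ : ℕ → ℝ) :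
    (1 + Amat N μ)ᴴ = 1 + (Amat N μ)ᴴ := by simp

theorem conjTranspose_Wch (N : ℕ) (a : ℝ) (μ δ : ℕ → ℝ) (lam x : ℕ) :
    (Wch N a μ δ lam x)ᴴ = Wch N a μ δ lam x := by
  have hT : (Tmat N δ)ᴴ = Tmat N δ := by
    simp only [Tmat, diagonal_conjTranspose]
    congr 1; ext i; simp
  simp only [Wch, ← conjTranspose_one_add_Amat, conjTranspose_smul, conjTranspose_mul,
    conjTranspose_pow, conjTranspose_conjTranspose, hT, mul_assoc]
  simp

theorem mul_Wch_eq (N : ℕ) (a : ℝ) (μ δ : ℕ → ℝ) (lam x : ℕ) :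
    ((a : ℂ) • (1 + Amat N μ)) * Wch N a μ δ lam x
      = Wch N a μ δ lam (x + 1) * (((x + 1 : ℕ) : ℂ) • (1 + Amat N μ)⁻¹)ᴴ := by
  have hu : IsUnit ((1 + Amat N μ)ᴴ).det := by
    rw [det_conjTranspose, det_one_add_Amat]; simp
  simp only [Wch, ← conjTranspose_one_add_Amat]
  set B := 1 + Amat N μ
  have h1 : Bᴴ ^ (x + 1 + lam) * (Bᴴ)⁻¹ = Bᴴ ^ (x + lam) := by
    rw [show x + 1 + lam = x + lam + 1 by ring, pow_succ, mul_nonsing_inv_cancel_right _ _ hu]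
  rw [conjTranspose_smul, conjTranspose_nonsing_inv, smul_mul_smul_comm, smul_mul_smul_comm,
    mul_assoc _ (Bᴴ ^ _) _, h1, ← mul_assoc, ← mul_assoc, ← pow_succ']
  congr 1
  · have : ((x : ℂ) + 1) ≠ 0 := by exact_mod_cast x.succ_ne_zero
    have h2 : (x.factorial : ℂ) ≠ 0 := by exact_mod_cast x.factorial_ne_zero
    simp [Nat.factorial_succ]
    field_simp
    ring
  · rw [show x + 1 + lam = x + lam + 1 by ring]

theorem diag_mul_Wch_eq (N : ℕ) (a : ℝ) (μ δ : ℕ → ℝ) (lam x : ℕ) :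
    (Jdiag N + ((x : ℂ) + lam) • (1 + Amat N μ)⁻¹) * Wch N a μ δ lam x
      = Wch N a μ δ lam x * (Jdiag N + ((x : ℂ) + lam) • (1 + Amat N μ)⁻¹)ᴴ := by
  have hD : ((Jdiag N + ((x + lam : ℕ) : ℂ) • 1) * Tmat N δ)ᴴ
      = (Jdiag N + ((x + lam : ℕ) : ℂ) • 1) * Tmat N δ := by
    have h1 : Jdiag N + ((x + lam : ℕ) : ℂ) • (1 : Mat N)
        = diagonal fun j : Fin N => ((j : ℕ) + 1 : ℂ) + ((x + lam : ℕ) : ℂ) := by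
      rw [Jdiag, ← diagonal_one, ← diagonal_smul, diagonal_add]
      simp
    rw [h1, Tmat, diagonal_mul_diagonal, diagonal_conjTranspose]
    congr 1; ext i; simp
  have h : (Jdiag N + ((x : ℂ) + lam) • (1 + Amat N μ)⁻¹) * Wch N a μ δ lam x
      = ((a ^ x / x.factorial : ℝ) : ℂ) • ((1 + Amat N μ) ^ (x + lam)
        * ((Jdiag N + ((x + lam : ℕ) : ℂ) • 1) * Tmat N δ) * ((1 + Amat N μ)ᴴ) ^ (x + lam)) := by
    have := Jdiag_mul_pow N μ (x + lam)
    rw [Wch, mul_smul_comm, conjTranspose_one_add_Amat, ← mul_assoc, ← mul_assoc, ← mul_assoc,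
      ← this]
    push_cast
    rfl
  rw [← conjTranspose_conjTranspose (Wch N a μ δ lam x * _), conjTranspose_mul,
    conjTranspose_conjTranspose, conjTranspose_Wch, h, conjTranspose_smul, conjTranspose_mul,
    conjTranspose_mul, hD]
  simp [mul_assoc, conjTranspose_pow]

/-- The weight is positive definite at every point of `ℕ`. -/
theorem exists_factor_Wch (N : ℕ) {a : ℝ} (ha : 0 < a) (μ : ℕ → ℝ) {δ : ℕ → ℝ}
    (hδ : ∀ k : ℕ, 1 ≤ k → k ≤ N → 0 < δ k) (lam x : ℕ) :
    ∃ E : Mat N, IsUnit E ∧ Wch N a μ δ lam x = E * Eᴴ := by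
  set D : Mat N := diagonal fun k : Fin N => ((√(a ^ x / x.factorial * δ (k + 1)) : ℝ) : ℂ) with hD
  have hpos (k : Fin N) : 0 < a ^ x / x.factorial * δ (k + 1) := by
    have := hδ (k + 1) (by lia) (by lia)
    positivity
  have hDD : D * Dᴴ = ((a ^ x / x.factorial : ℝ) : ℂ) • Tmat N δ := by
    rw [hD, diagonal_conjTranspose, diagonal_mul_diagonal, Tmat, ← diagonal_smul]
    congr 1; ext k
    have := Real.mul_self_sqrt (hpos k).le
    simp only [Pi.star_apply, RCLike.star_def, Complex.conj_ofReal, Pi.smul_apply, smul_eq_mul]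
    rw [← Complex.ofReal_mul, this, Complex.ofReal_mul]
  refine ⟨(1 + Amat N μ) ^ (x + lam) * D, ?_, ?_⟩
  · refine IsUnit.mul (IsUnit.pow _ ?_) ?_
    · rw [isUnit_iff_isUnit_det, det_one_add_Amat]; exact isUnit_one
    · rw [isUnit_iff_isUnit_det, hD, det_diagonal, isUnit_iff_ne_zero, Finset.prod_ne_zero_iff]
      intro k _
      exact_mod_cast (Real.sqrt_pos.2 (hpos k)).ne'
  · rw [conjTranspose_mul, mul_assoc, ← mul_assoc D, hDD, conjTranspose_pow,
      conjTranspose_one_add_Amat, Wch]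
    simp [mul_assoc]

theorem eq_zero_of_pairing_self_eq_zero {N : ℕ} (hN : 1 ≤ N) {a : ℝ} (ha : 0 < a) (μ : ℕ → ℝ)
    {δ : ℕ → ℝ} (hδ : ∀ k : ℕ, 1 ≤ k → k ≤ N → 0 < δ k) (lam : ℕ) {d : ℕ} {f : ℂ → Mat N}
    (hf : f ∈ polyFun N d) (h : pairing (Wch N a μ δ lam) f f = 0) : f = 0 := by
  refine eq_zero_of_natCast_eq_zero hf ?_
  choose E hE hW using exists_factor_Wch N ha μ hδ lam
  have hs := (summable_innerN_Wch hN ha μ δ lam hf hf).hasSum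
  have ht : HasSum (fun x : ℕ => ((f x * E x) * (f x * E x)ᴴ).trace.re) 0 := by
    have h0 : (∑' x : ℕ, f x * Wch N a μ δ lam x * (f x)ᴴ) = 0 := h
    rw [h0] at hs
    have hc : Continuous fun C : Mat N => C.trace.re :=
      Complex.continuous_re.comp (continuous_id.matrix_trace)
    let φ : Mat N →+ ℝ :=
      { toFun := fun C => C.trace.re, map_zero' := by simp, map_add' := by simp }
    have := hs.map φ hc
    simpa [φ, Function.comp_def, hW, conjTranspose_mul, mul_assoc] using this
  have hn (x : ℕ) : 0 ≤ ((f x * E x) * (f x * E x)ᴴ).trace :=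
    (posSemidef_self_mul_conjTranspose _).trace_nonneg
  have hz := (hasSum_zero_iff_of_nonneg fun x => (Complex.nonneg_iff.1 (hn x)).1).1 ht
  intro x
  have h1 : ((f x * E x) * (f x * E x)ᴴ).trace = 0 :=
    Complex.ext (congrFun hz x) (Complex.nonneg_iff.1 (hn x)).2.symm
  exact ((hE x).mul_left_eq_zero).1 (trace_mul_conjTranspose_self_eq_zero_iff.1 h1)

theorem conjTranspose_pairing {N : ℕ} (a : ℝ) (μ δ : ℕ → ℝ) (lam : ℕ) (f g : ℂ → Mat N) :
    (pairing (Wch N a μ δ lam) f g)ᴴ = pairing (Wch N a μ δ lam) g f := by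
  simp only [pairing, conjTranspose_tsum, conjTranspose_mul, conjTranspose_conjTranspose,
    conjTranspose_Wch, mul_assoc]

theorem pairing_leftMul_left {N : ℕ} (W : ℕ → Mat N) (C : Mat N) (f g : ℂ → Mat N)
    (h : Summable fun x : ℕ => f x * W x * (g x)ᴴ) :
    pairing W (leftMul C f) g = C * pairing W f g := by
  simp only [pairing, leftMul, LinearMap.coe_mk, AddHom.coe_mk, mul_assoc]
  exact (by simpa only [mul_assoc] using h : Summable _).tsum_mul_left C

theorem pairing_leftMul_right {N : ℕ} (W : ℕ → Mat N) (C : Mat N) (f g : ℂ → Mat N)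
    (h : Summable fun x : ℕ => f x * W x * (g x)ᴴ) :
    pairing W f (leftMul C g) = pairing W f g * Cᴴ := by
  simp only [pairing, leftMul, LinearMap.coe_mk, AddHom.coe_mk, conjTranspose_mul, ← mul_assoc]
  exact h.tsum_mul_right Cᴴ

theorem pairing_add_left {N : ℕ} {W : ℕ → Mat N} {f₁ f₂ g : ℂ → Mat N}
    (h₁ : Summable fun x : ℕ => f₁ x * W x * (g x)ᴴ)
    (h₂ : Summable fun x : ℕ => f₂ x * W x * (g x)ᴴ) :
    pairing W (f₁ + f₂) g = pairing W f₁ g + pairing W f₂ g := by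
  simp only [pairing, Pi.add_apply, add_mul]
  exact h₁.tsum_add h₂

theorem pairing_sub_left {N : ℕ} {W : ℕ → Mat N} {f₁ f₂ g : ℂ → Mat N}
    (h₁ : Summable fun x : ℕ => f₁ x * W x * (g x)ᴴ)
    (h₂ : Summable fun x : ℕ => f₂ x * W x * (g x)ᴴ) :
    pairing W (f₁ - f₂) g = pairing W f₁ g - pairing W f₂ g := by
  simp only [pairing, Pi.sub_apply, sub_mul]
  exact h₁.tsum_sub h₂

theorem pairing_add_right {N : ℕ} {W : ℕ → Mat N} {f g₁ g₂ : ℂ → Mat N}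
    (h₁ : Summable fun x : ℕ => f x * W x * (g₁ x)ᴴ)
    (h₂ : Summable fun x : ℕ => f x * W x * (g₂ x)ᴴ) :
    pairing W f (g₁ + g₂) = pairing W f g₁ + pairing W f g₂ := by
  simp only [pairing, Pi.add_apply, conjTranspose_add, mul_add]
  exact h₁.tsum_add h₂

theorem pairing_sub_right {N : ℕ} {W : ℕ → Mat N} {f g₁ g₂ : ℂ → Mat N}
    (h₁ : Summable fun x : ℕ => f x * W x * (g₁ x)ᴴ)
    (h₂ : Summable fun x : ℕ => f x * W x * (g₂ x)ᴴ) :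
    pairing W f (g₁ - g₂) = pairing W f g₁ - pairing W f g₂ := by
  simp only [pairing, Pi.sub_apply, conjTranspose_sub, mul_sub]
  exact h₁.tsum_sub h₂

/-- The forward part `f ↦ f (z + 1) a (1 + A)` of the difference operator. -/
def forwardPart (N : ℕ) (a : ℝ) (μ : ℕ → ℝ) : (ℂ → Mat N) →ₗ[ℂ] (ℂ → Mat N) :=
  shiftMul 1 (fun _ => 1) ((a : ℂ) • (1 + Amat N μ))

/-- The backward part `f ↦ f (z - 1) z (1 + A)⁻¹` of the difference operator. -/
def backwardPart (N : ℕ) (μ : ℕ → ℝ) : (ℂ → Mat N) →ₗ[ℂ] (ℂ → Mat N) :=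
  shiftMul (-1) (fun z => z) (1 + Amat N μ)⁻¹

/-- The zeroth order part `f ↦ f z (J + (z + λ) (1 + A)⁻¹)` of the difference operator. -/
def diagonalPart (N : ℕ) (μ : ℕ → ℝ) (lam : ℕ) : (ℂ → Mat N) →ₗ[ℂ] (ℂ → Mat N) :=
  shiftMul 0 (fun _ => 1) (Jdiag N) + shiftMul 0 (fun z => z + lam) (1 + Amat N μ)⁻¹

/-- The second order difference operator. -/
def diffOp (N : ℕ) (a : ℝ) (μ : ℕ → ℝ) (lam : ℕ) : (ℂ → Mat N) →ₗ[ℂ] (ℂ → Mat N) :=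
  forwardPart N a μ - diagonalPart N μ lam + backwardPart N μ

theorem forwardPart_mem {N d : ℕ} (a : ℝ) (μ : ℕ → ℝ) {f : ℂ → Mat N} (hf : f ∈ polyFun N d) :
    forwardPart N a μ f ∈ polyFun N (d + 1) :=
  shiftMul_mem_polyFun 1 1 _ (by simp) (by simp) hf

theorem backwardPart_mem {N d : ℕ} (μ : ℕ → ℝ) {f : ℂ → Mat N} (hf : f ∈ polyFun N d) :
    backwardPart N μ f ∈ polyFun N (d + 1) :=
  shiftMul_mem_polyFun (-1) X _ (by simp) (by simp [add_comm]) hf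

theorem diagonalPart_mem {N d : ℕ} (μ : ℕ → ℝ) (lam : ℕ) {f : ℂ → Mat N}
    (hf : f ∈ polyFun N d) : diagonalPart N μ lam f ∈ polyFun N (d + 1) := by
  refine Submodule.add_mem _ ?_ ?_
  · exact shiftMul_mem_polyFun 0 1 _ (by simp) (by simp) hf
  · exact shiftMul_mem_polyFun 0 (X + Polynomial.C (lam : ℂ)) _ (by simp)
      (by rw [natDegree_X_add_C, add_comm]) hf

theorem pairing_forwardPart {N : ℕ} (hN : 1 ≤ N) {a : ℝ} (ha : 0 < a) (μ δ : ℕ → ℝ) (lam : ℕ)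
    {d e : ℕ} {f g : ℂ → Mat N} (hf : f ∈ polyFun N d) (hg : g ∈ polyFun N e) :
    pairing (Wch N a μ δ lam) (forwardPart N a μ f) g
      = pairing (Wch N a μ δ lam) f (backwardPart N μ g) := by
  rw [pairing, pairing,
    (summable_innerN_Wch hN ha μ δ lam hf (backwardPart_mem μ hg)).tsum_eq_zero_add]
  have h0 : backwardPart N μ g ((0 : ℕ) : ℂ) = 0 := by simp [backwardPart, shiftMul]
  rw [h0, conjTranspose_zero, mul_zero, zero_add]
  congr 1; ext1 x
  have h1 : backwardPart N μ g ((x + 1 : ℕ) : ℂ)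
      = g x * (((x + 1 : ℕ) : ℂ) • (1 + Amat N μ)⁻¹) := by
    simp [backwardPart, shiftMul]
  have h2 : forwardPart N a μ f x = f ((x + 1 : ℕ) : ℂ) * ((a : ℂ) • (1 + Amat N μ)) := by
    simp [forwardPart, shiftMul]
  rw [h1, h2, mul_assoc (f _), mul_Wch_eq, conjTranspose_mul]
  simp only [mul_assoc]

theorem pairing_backwardPart {N : ℕ} (hN : 1 ≤ N) {a : ℝ} (ha : 0 < a) (μ δ : ℕ → ℝ) (lam : ℕ)
    {d e : ℕ} {f g : ℂ → Mat N} (hf : f ∈ polyFun N d) (hg : g ∈ polyFun N e) :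
    pairing (Wch N a μ δ lam) (backwardPart N μ f) g
      = pairing (Wch N a μ δ lam) f (forwardPart N a μ g) := by
  rw [← conjTranspose_pairing, ← pairing_forwardPart hN ha μ δ lam hg hf, conjTranspose_pairing]

theorem pairing_diagonalPart {N : ℕ} (a : ℝ) (μ δ : ℕ → ℝ) (lam : ℕ) (f g : ℂ → Mat N) :
    pairing (Wch N a μ δ lam) (diagonalPart N μ lam f) g
      = pairing (Wch N a μ δ lam) f (diagonalPart N μ lam g) := by
  have h (f : ℂ → Mat N) (x : ℕ) : diagonalPart N μ lam f x
      = f x * (Jdiag N + ((x : ℂ) + lam) • (1 + Amat N μ)⁻¹) := by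
    simp [diagonalPart, shiftMul, mul_add]
  rw [pairing, pairing]
  congr 1; ext1 x
  rw [h, h, mul_assoc (f _), diag_mul_Wch_eq, conjTranspose_mul]
  simp only [mul_assoc]

theorem pairing_diffOp {N : ℕ} (hN : 1 ≤ N) {a : ℝ} (ha : 0 < a) (μ δ : ℕ → ℝ) (lam : ℕ)
    {d e : ℕ} {f g : ℂ → Mat N} (hf : f ∈ polyFun N d) (hg : g ∈ polyFun N e) :
    pairing (Wch N a μ δ lam) (diffOp N a μ lam f) g
      = pairing (Wch N a μ δ lam) f (diffOp N a μ lam g) := by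
  have hs {d e : ℕ} {f g : ℂ → Mat N} (hf : f ∈ polyFun N d) (hg : g ∈ polyFun N e) :=
    summable_innerN_Wch hN ha μ δ lam hf hg
  simp only [diffOp, LinearMap.add_apply, LinearMap.sub_apply]
  have F {d} {f : ℂ → Mat N} (hf : f ∈ polyFun N d) := forwardPart_mem a μ hf
  have B {d} {f : ℂ → Mat N} (hf : f ∈ polyFun N d) := backwardPart_mem μ hf
  have D {d} {f : ℂ → Mat N} (hf : f ∈ polyFun N d) := diagonalPart_mem μ lam hf
  rw [pairing_add_left (hs (Submodule.sub_mem _ (F hf) (D hf)) hg) (hs (B hf) hg),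
    pairing_sub_left (hs (F hf) hg) (hs (D hf) hg),
    pairing_add_right (hs hf (Submodule.sub_mem _ (F hg) (D hg))) (hs hf (B hg)),
    pairing_sub_right (hs hf (F hg)) (hs hf (D hg)),
    pairing_forwardPart hN ha μ δ lam hf hg, pairing_backwardPart hN ha μ δ lam hf hg,
    pairing_diagonalPart]
  abel

theorem mul_mem_degreeLT_succ {p q : ℂ[X]} {n : ℕ} (hp : p.natDegree ≤ 1)
    (hq : q ∈ degreeLT ℂ n) : p * q ∈ degreeLT ℂ (n + 1) := by
  rcases eq_or_ne q 0 with rfl | hq0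
  · simp
  rw [mem_degreeLT, degree_eq_natDegree hq0] at hq
  rw [mem_degreeLT]
  refine lt_of_le_of_lt degree_le_natDegree ?_
  have h1 := natDegree_mul_le (p := p) (q := q)
  norm_cast at hq ⊢
  lia

theorem X_pow_mem_degreeLT (n : ℕ) : (X ^ n : ℂ[X]) ∈ degreeLT ℂ (n + 1) := by
  rw [mem_degreeLT, degree_X_pow]
  exact_mod_cast n.lt_succ_self

theorem X_add_one_pow_sub_mem_degreeLT (n : ℕ) :
    ((X + 1) ^ n - X ^ n : ℂ[X]) ∈ degreeLT ℂ n := by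
  induction n with
  | zero => simp
  | succ n ih =>
    have h : ((X + 1) ^ (n + 1) - X ^ (n + 1) : ℂ[X])
        = (X + 1) * ((X + 1) ^ n - X ^ n) + X ^ n := by ring
    rw [h]
    exact Submodule.add_mem _ (mul_mem_degreeLT_succ (by compute_degree) ih)
      (X_pow_mem_degreeLT n)

theorem X_mul_X_sub_one_pow_mem_degreeLT (n : ℕ) :
    (X * (X - 1) ^ n - X ^ (n + 1) + Polynomial.C (n : ℂ) * X ^ n : ℂ[X]) ∈ degreeLT ℂ n := by
  induction n with
  | zero => simp
  | succ n ih =>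
    have h : (X * (X - 1) ^ (n + 1) - X ^ (n + 1 + 1)
          + Polynomial.C ((n + 1 : ℕ) : ℂ) * X ^ (n + 1) : ℂ[X])
        = (X - 1) * (X * (X - 1) ^ n - X ^ (n + 1) + Polynomial.C (n : ℂ) * X ^ n)
          + (n : ℂ) • X ^ n := by
      rw [smul_eq_C_mul]; push_cast; simp only [map_add, map_one]; ring
    rw [h]
    exact Submodule.add_mem _ (mul_mem_degreeLT_succ (by compute_degree) ih)
      (Submodule.smul_mem _ _ (X_pow_mem_degreeLT n))

/-- The eigenvalue of the second order difference operator in degree `n`. -/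
def eigenMat (N : ℕ) (a : ℝ) (μ : ℕ → ℝ) (lam n : ℕ) : Mat N :=
  (a : ℂ) • (1 + Amat N μ) - Jdiag N - ((n : ℂ) + (lam : ℂ)) • (1 + Amat N μ)⁻¹

theorem diffOp_pow_smul_sub_mem {N : ℕ} (a : ℝ) (μ : ℕ → ℝ) (lam k : ℕ) (C : Mat N) :
    (diffOp N a μ lam (fun z => z ^ k • C) - fun z : ℂ => z ^ k • (C * eigenMat N a μ lam k))
      ∈ polyFun N k := by
  convert Submodule.add_mem _
    (eval_smul_mem_polyFun (X_add_one_pow_sub_mem_degreeLT k) (C * ((a : ℂ) • (1 + Amat N μ))))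
    (eval_smul_mem_polyFun (X_mul_X_sub_one_pow_mem_degreeLT k) (C * (1 + Amat N μ)⁻¹)) using 1
  ext1 z
  simp only [diffOp, forwardPart, diagonalPart, backwardPart, shiftMul, eigenMat,
    LinearMap.add_apply, LinearMap.sub_apply, LinearMap.coe_mk, AddHom.coe_mk, Pi.add_apply,
    Pi.sub_apply, eval_add, eval_sub, eval_mul, eval_pow, eval_X, eval_C, eval_one,
    mul_add, mul_sub, mul_smul_comm, smul_mul_assoc, ← sub_eq_add_neg, add_zero]
  module

theorem diffOp_mem {N d : ℕ} (a : ℝ) (μ : ℕ → ℝ) (lam : ℕ) {f : ℂ → Mat N}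
    (hf : f ∈ polyFun N d) : diffOp N a μ lam f ∈ polyFun N d := by
  refine map_mem_polyFun _ (fun k hk C => ?_) hf
  exact (Submodule.sub_mem_iff_left _ (pow_smul_mem_polyFun hk _)).1
    (polyFun_mono hk.le (diffOp_pow_smul_sub_mem a μ lam k C))

theorem pairing_eq_zero_of_mem {N : ℕ} (hN : 1 ≤ N) {a : ℝ} (ha : 0 < a) {μ δ : ℕ → ℝ} {lam : ℕ}
    {P : ℕ → Polynomial (Mat N)} (hP : IsMOSN (Wch N a μ δ lam) P) (n d : ℕ) (hd : d ≤ n)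
    {f : ℂ → Mat N} (hf : f ∈ polyFun N d) :
    pairing (Wch N a μ δ lam) (matEval (P n)) f = 0 := by
  induction d using Nat.strong_induction_on generalizing f with
  | _ d ih =>
  have hPn := matEval_mem_polyFun (hP.deg n)
  have hs {e : ℕ} {g : ℂ → Mat N} (hg : g ∈ polyFun N e) :=
    summable_innerN_Wch hN ha μ δ lam hPn hg
  induction hf using Submodule.span_induction with
  | mem f h =>
    obtain ⟨k, hk, C, rfl⟩ := h
    have hPk := matEval_mem_polyFun (hP.deg k)
    have hr := matEval_sub_mem_polyFun (hP.monic k) (hP.deg k)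
    have he : (fun z : ℂ => z ^ k • C) = leftMul C (matEval (P k))
        - leftMul C (matEval (P k) - fun z : ℂ => z ^ k • (1 : Mat N)) := by
      rw [← map_sub]; ext1 z; simp [leftMul]
    have h0 : pairing (Wch N a μ δ lam) (matEval (P n)) (matEval (P k)) = 0 :=
      hP.orth n k (by lia)
    rw [he, pairing_sub_right (hs (leftMul_mem_polyFun C hPk)) (hs (leftMul_mem_polyFun C hr)),
      ih k hk (by lia) (leftMul_mem_polyFun C hr), pairing_leftMul_right _ _ _ _ (hs hPk), h0,
      zero_mul, sub_zero]
  | zero => simp [pairing]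
  | add f g hf hg h1 h2 => rw [pairing_add_right (hs hf) (hs hg), h1, h2, add_zero]
  | smul c f hf h1 =>
    have : c • f = leftMul (c • (1 : Mat N)) f := by ext1 z; simp [leftMul]
    rw [this, pairing_leftMul_right _ _ _ _ (hs hf), h1, zero_mul]

/-- the monic matrix Charlier polynomials are eigenfunctions of the
second order difference operator `𝔇^{(λ)}`, with eigenvalue
`Γ_n^{(λ)} = a(I+A) - J - (n+λ)(I+A)⁻¹`. -/
theorem charlier_second_order_difference (N : ℕ) (hN : 1 ≤ N) (a : ℝ) (ha : 0 < a)
    (μ : ℕ → ℝ) (hμ : ∀ j : ℕ, 1 ≤ j → j ≤ N → 0 < μ j)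
    (δ : ℕ → ℕ → ℝ) (hδ : ∀ lam k : ℕ, 1 ≤ k → k ≤ N → 0 < δ lam k)
    (lam : ℕ)
    (P : ℕ → Polynomial (Mat N)) (hP : IsMOSN (Wch N a μ (δ lam) lam) P) :
    ∀ n : ℕ, ∀ z : ℂ,
      matEval (P n) (z + 1) * ((a : ℂ) • (1 + Amat N μ))
          - matEval (P n) z * (Jdiag N + (z + (lam : ℂ)) • (1 + Amat N μ)⁻¹)
          + matEval (P n) (z - 1) * (z • (1 + Amat N μ)⁻¹)
        = ((a : ℂ) • (1 + Amat N μ) - Jdiag N - ((n : ℂ) + (lam : ℂ)) • (1 + Amat N μ)⁻¹)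
            * matEval (P n) z := by
  intro n z
  have hδ' := hδ lam
  set f := matEval (P n)
  have hfm : f ∈ polyFun N (n + 1) := matEval_mem_polyFun (hP.deg n)
  set Γ := eigenMat N a μ lam n
  set R := diffOp N a μ lam f - leftMul Γ f with hR
  have hRm : R ∈ polyFun N n := by
    have hr : f - _ ∈ polyFun N n := matEval_sub_mem_polyFun (hP.monic n) (hP.deg n)
    have he : R = (diffOp N a μ lam (fun z : ℂ => z ^ n • (1 : Mat N))
          - fun z : ℂ => z ^ n • (1 * Γ))
        + (diffOp N a μ lam (f - fun z : ℂ => z ^ n • (1 : Mat N))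
          - leftMul Γ (f - fun z : ℂ => z ^ n • (1 : Mat N))) := by
      have h1 : (fun z : ℂ => z ^ n • (1 * Γ)) = leftMul Γ (fun z : ℂ => z ^ n • (1 : Mat N)) := by
        ext1 z; simp [leftMul]
      rw [h1, map_sub, map_sub, hR]
      abel
    rw [he]
    exact Submodule.add_mem _ (diffOp_pow_smul_sub_mem a μ lam n 1)
      (Submodule.sub_mem _ (diffOp_mem a μ lam hr) (leftMul_mem_polyFun Γ hr))
  have hs {e : ℕ} {g : ℂ → Mat N} (hg : g ∈ polyFun N e) :=
    summable_innerN_Wch hN ha μ (δ lam) lam hg hRm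
  have hRR : pairing (Wch N a μ (δ lam) lam) R R = 0 := by
    nth_rewrite 1 [hR]
    rw [pairing_sub_left (hs (diffOp_mem a μ lam hfm)) (hs (leftMul_mem_polyFun Γ hfm)),
      pairing_diffOp hN ha μ (δ lam) lam hfm hRm, pairing_leftMul_left _ _ _ _ (hs hfm),
      pairing_eq_zero_of_mem hN ha hP n n le_rfl (diffOp_mem a μ lam hRm),
      pairing_eq_zero_of_mem hN ha hP n n le_rfl hRm, mul_zero, sub_zero]
  have h0 := congrFun (eq_zero_of_pairing_self_eq_zero hN ha μ hδ' lam hRm hRR) z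
  rw [hR, Pi.sub_apply, Pi.zero_apply, sub_eq_zero] at h0
  convert h0 using 1
  · simp [diffOp, forwardPart, diagonalPart, backwardPart, shiftMul, mul_add, sub_eq_add_neg]
  · rfl
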